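/- Every matrix representation 𝔸 of the chain quiver with vertices 1,…,t (with an arbitrary fixed orientation of the arrows) over ℂ is isomorphic to a direct sum of representations L_{ij} with 1 ≤ i ≤ j ≤ t; moreover the multiset of pairs (i,j) occurring in such a direct sum is uniquely determined by 𝔸 (the decomposition is unique up to permutation of summands). -/

import Mathlib

open Matrix

namespace ChainQuiver

/-! The chain quiver has vertices `0, 1, …, m` (i.e. `t = m + 1` vertices) and arrows
`α_i` joining vertices `i` and `i+1` for `i = 0, …, m - 1`.  The orientation is given
by `ε : Fin m → Bool`: `ε i = true` means `α_i : i → i+1`, and `ε i = false` means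
`α_i : i+1 → i`. -/

/-- Source vertex of the arrow `α_i`. -/
def src {m : ℕ} (ε : Fin m → Bool) (i : Fin m) : Fin (m + 1) :=
  if ε i then i.castSucc else i.succ

/-- Target vertex of the arrow `α_i`. -/
def tgt {m : ℕ} (ε : Fin m → Bool) (i : Fin m) : Fin (m + 1) :=
  if ε i then i.succ else i.castSucc

/-- A matrix representation of the chain quiver: a dimension at each vertex and, for
each arrow, a (target-dim) × (source-dim) complex matrix. -/
structure Rep (m : ℕ) (ε : Fin m → Bool) where
  d : Fin (m + 1) → ℕ
  A : ∀ i : Fin m, Matrix (Fin (d (tgt ε i))) (Fin (d (src ε i))) ℂ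

variable {m : ℕ} {ε : Fin m → Bool}

/-- Isomorphism of representations: invertible matrices `S v` (with two-sided
inverses `T v`) at each vertex with `Y.A i = S (tgt i) * X.A i * (S (src i))⁻¹`. -/
def Iso (X Y : Rep m ε) : Prop :=
  ∃ (S : ∀ v, Matrix (Fin (Y.d v)) (Fin (X.d v)) ℂ)
    (T : ∀ v, Matrix (Fin (X.d v)) (Fin (Y.d v)) ℂ),
    (∀ v, S v * T v = 1) ∧ (∀ v, T v * S v = 1) ∧
    ∀ i, Y.A i = S (tgt ε i) * X.A i * T (src ε i)

/-- Arrow-wise block-diagonal direct sum of representations. -/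
noncomputable def dsum (X Y : Rep m ε) : Rep m ε where
  d v := X.d v + Y.d v
  A i := Matrix.reindex finSumFinEquiv finSumFinEquiv
    (Matrix.fromBlocks (X.A i) 0 0 (Y.A i))

/-- The zero representation. -/
def zero (m : ℕ) (ε : Fin m → Bool) : Rep m ε := ⟨fun _ => 0, fun _ => 0⟩

/-- Direct sum of a list of representations. -/
noncomputable def dsumList (L : List (Rep m ε)) : Rep m ε := L.foldr dsum (zero m ε)

/-- The indecomposable representation `L_{ij}` (for `i ≤ j`): dimension `1` at the
vertices `i, …, j` and `0` elsewhere; the matrices between consecutive vertices of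
`{i, …, j}` are `1 × 1` identities and all other matrices are empty. -/
def interval (ε : Fin m → Bool) (i j : Fin (m + 1)) : Rep m ε where
  d v := if i ≤ v ∧ v ≤ j then 1 else 0
  A _ := Matrix.of fun _ _ => 1

/-- A representation is nonzero if some vertex has nonzero dimension. -/
def Nonzero (X : Rep m ε) : Prop := ∃ v, X.d v ≠ 0

/-- Indecomposability: nonzero and not isomorphic to a direct sum of two nonzero
representations. -/
def Indecomposable (X : Rep m ε) : Prop :=
  Nonzero X ∧ ¬ ∃ Y Z : Rep m ε, Nonzero Y ∧ Nonzero Z ∧ Iso X (dsum Y Z)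

end ChainQuiver

namespace ChainQuiver


/-- `x` is a morphism from the interval representation `[i,j]` to `X`. -/
structure IsX {m : ℕ} {ε : Fin m → Bool} (X : Rep m ε) (i j : Fin (m + 1))
    (x : ∀ w, Fin (X.d w) → ℂ) : Prop where
  out : ∀ w, ¬ (i ≤ w ∧ w ≤ j) → x w = 0
  arr : ∀ a, (i ≤ src ε a ∧ src ε a ≤ j) → X.A a *ᵥ x (src ε a) = x (tgt ε a)

/-- `f` is a morphism from `X` to the interval representation `[i,j]`. -/
structure IsF {m : ℕ} {ε : Fin m → Bool} (X : Rep m ε) (i j : Fin (m + 1))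
    (f : ∀ w, Fin (X.d w) → ℂ) : Prop where
  out : ∀ w, ¬ (i ≤ w ∧ w ≤ j) → f w = 0
  arr : ∀ a, (i ≤ tgt ε a ∧ tgt ε a ≤ j) → f (tgt ε a) ᵥ* X.A a = f (src ε a)

lemma src_tgt {m : ℕ} (ε : Fin m → Bool) (a : Fin m) :
    (src ε a = a.castSucc ∧ tgt ε a = a.succ) ∨ (src ε a = a.succ ∧ tgt ε a = a.castSucc) := by
  unfold src tgt
  cases ε a <;> simp

lemma iso_refl_symm {m : ℕ} {ε : Fin m → Bool} {X Y : Rep m ε} (h : Iso X Y) : Iso Y X := by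
  obtain ⟨S, T, h1, h2, h3⟩ := h
  refine ⟨T, S, h2, h1, fun i => ?_⟩
  rw [h3]
  simp only [← Matrix.mul_assoc, h2, Matrix.one_mul]
  rw [Matrix.mul_assoc, h2, Matrix.mul_one]

lemma iso_trans {m : ℕ} {ε : Fin m → Bool} {X Y Z : Rep m ε} (h : Iso X Y) (h' : Iso Y Z) :
    Iso X Z := by
  obtain ⟨S, T, h1, h2, h3⟩ := h
  obtain ⟨S', T', h1', h2', h3'⟩ := h'
  refine ⟨fun v => S' v * S v, fun v => T v * T' v, fun v => ?_, fun v => ?_, fun i => ?_⟩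
  · rw [Matrix.mul_assoc, ← Matrix.mul_assoc (S v), h1, Matrix.one_mul, h1']
  · rw [Matrix.mul_assoc, ← Matrix.mul_assoc (T' v), h2', Matrix.one_mul, h2]
  · rw [h3', h3]; simp only [Matrix.mul_assoc]

/-- Transport of a Gram-identity system along an isomorphism. -/
lemma transport_X {m : ℕ} {ε : Fin m → Bool} {X Y : Rep m ε} {i j : Fin (m + 1)}
    {S : ∀ v, Matrix (Fin (Y.d v)) (Fin (X.d v)) ℂ}
    {T : ∀ v, Matrix (Fin (X.d v)) (Fin (Y.d v)) ℂ}
    (h2 : ∀ v, T v * S v = 1)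
    (h3 : ∀ i, Y.A i = S (tgt ε i) * X.A i * T (src ε i)) {x : ∀ w, Fin (X.d w) → ℂ}
    (hx : IsX X i j x) : IsX Y i j (fun w => S w *ᵥ x w) := by
  constructor
  · intro w hw
    simp [hx.out w hw]
  · intro a ha
    rw [h3, Matrix.mulVec_mulVec, Matrix.mul_assoc, h2, Matrix.mul_one, ← Matrix.mulVec_mulVec,
      hx.arr a ha]

lemma transport_F {m : ℕ} {ε : Fin m → Bool} {X Y : Rep m ε} {i j : Fin (m + 1)}
    {S : ∀ v, Matrix (Fin (Y.d v)) (Fin (X.d v)) ℂ}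
    {T : ∀ v, Matrix (Fin (X.d v)) (Fin (Y.d v)) ℂ}
    (h2 : ∀ v, T v * S v = 1)
    (h3 : ∀ i, Y.A i = S (tgt ε i) * X.A i * T (src ε i)) {f : ∀ w, Fin (X.d w) → ℂ}
    (hf : IsF X i j f) : IsF Y i j (fun w => f w ᵥ* T w) := by
  constructor
  · intro w hw
    simp [hf.out w hw]
  · intro a ha
    rw [h3, Matrix.vecMul_vecMul, Matrix.mul_assoc, ← Matrix.mul_assoc, h2, Matrix.one_mul,
      ← Matrix.vecMul_vecMul, hf.arr a ha]

/-- First component of a vector on a direct sum. -/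
def lft {a b : ℕ} (z : Fin (a + b) → ℂ) : Fin a → ℂ := fun k => z (Fin.castAdd b k)
/-- Second component of a vector on a direct sum. -/
def rgt {a b : ℕ} (z : Fin (a + b) → ℂ) : Fin b → ℂ := fun k => z (Fin.natAdd a k)

lemma lr_ext {a b : ℕ} {z z' : Fin (a + b) → ℂ} (h : lft z = lft z') (h' : rgt z = rgt z') :
    z = z' := by
  funext k
  refine Fin.addCases (fun k => congrFun h k) (fun k => congrFun h' k) k

lemma dot_lr {a b : ℕ} (z z' : Fin (a + b) → ℂ) :
    z ⬝ᵥ z' = lft z ⬝ᵥ lft z' + rgt z ⬝ᵥ rgt z' := by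
  simp [dotProduct, Fin.sum_univ_add, lft, rgt]

lemma lft_mulVec {a b c d : ℕ} (M : Matrix (Fin a) (Fin c) ℂ) (N : Matrix (Fin b) (Fin d) ℂ)
    (z : Fin (c + d) → ℂ) :
    lft ((Matrix.reindex finSumFinEquiv finSumFinEquiv (Matrix.fromBlocks M 0 0 N)) *ᵥ z)
      = M *ᵥ lft z := by
  funext k
  simp [lft, mulVec, dotProduct, Fin.sum_univ_add]

lemma rgt_mulVec {a b c d : ℕ} (M : Matrix (Fin a) (Fin c) ℂ) (N : Matrix (Fin b) (Fin d) ℂ)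
    (z : Fin (c + d) → ℂ) :
    rgt ((Matrix.reindex finSumFinEquiv finSumFinEquiv (Matrix.fromBlocks M 0 0 N)) *ᵥ z)
      = N *ᵥ rgt z := by
  funext k
  simp [rgt, mulVec, dotProduct, Fin.sum_univ_add]

lemma lft_vecMul {a b c d : ℕ} (M : Matrix (Fin a) (Fin c) ℂ) (N : Matrix (Fin b) (Fin d) ℂ)
    (z : Fin (a + b) → ℂ) :
    lft (z ᵥ* (Matrix.reindex finSumFinEquiv finSumFinEquiv (Matrix.fromBlocks M 0 0 N)))
      = lft z ᵥ* M := by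
  funext k
  simp [lft, vecMul, dotProduct, Fin.sum_univ_add]

lemma rgt_vecMul {a b c d : ℕ} (M : Matrix (Fin a) (Fin c) ℂ) (N : Matrix (Fin b) (Fin d) ℂ)
    (z : Fin (a + b) → ℂ) :
    rgt (z ᵥ* (Matrix.reindex finSumFinEquiv finSumFinEquiv (Matrix.fromBlocks M 0 0 N)))
      = rgt z ᵥ* N := by
  funext k
  simp [rgt, vecMul, dotProduct, Fin.sum_univ_add]

lemma isX_dsum {m : ℕ} {ε : Fin m → Bool} {Y Z : Rep m ε} {i j : Fin (m + 1)}
    {x : ∀ w, Fin (Y.d w + Z.d w) → ℂ} :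
    IsX (dsum Y Z) i j x ↔ IsX Y i j (fun w => lft (x w)) ∧ IsX Z i j (fun w => rgt (x w)) := by
  constructor
  · rintro ⟨h1, h2⟩
    refine ⟨⟨fun w hw => ?_, fun a ha => ?_⟩, ⟨fun w hw => ?_, fun a ha => ?_⟩⟩
    · have := h1 w hw
      rw [this]; rfl
    · rw [← lft_mulVec (Y.A a) (Z.A a)]
      exact congrArg lft (h2 a ha)
    · have := h1 w hw
      rw [this]; rfl
    · rw [← rgt_mulVec (Y.A a) (Z.A a)]
      exact congrArg rgt (h2 a ha)
  · rintro ⟨⟨h1, h2⟩, ⟨h3, h4⟩⟩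
    refine ⟨fun w hw => lr_ext (h1 w hw) (h3 w hw), fun a ha => lr_ext ?_ ?_⟩
    · exact (lft_mulVec (Y.A a) (Z.A a) _).trans (h2 a ha)
    · exact (rgt_mulVec (Y.A a) (Z.A a) _).trans (h4 a ha)

lemma isF_dsum {m : ℕ} {ε : Fin m → Bool} {Y Z : Rep m ε} {i j : Fin (m + 1)}
    {x : ∀ w, Fin (Y.d w + Z.d w) → ℂ} :
    IsF (dsum Y Z) i j x ↔ IsF Y i j (fun w => lft (x w)) ∧ IsF Z i j (fun w => rgt (x w)) := by
  constructor
  · rintro ⟨h1, h2⟩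
    refine ⟨⟨fun w hw => ?_, fun a ha => ?_⟩, ⟨fun w hw => ?_, fun a ha => ?_⟩⟩
    · have := h1 w hw
      rw [this]; rfl
    · rw [← lft_vecMul (Y.A a) (Z.A a)]
      exact congrArg lft (h2 a ha)
    · have := h1 w hw
      rw [this]; rfl
    · rw [← rgt_vecMul (Y.A a) (Z.A a)]
      exact congrArg rgt (h2 a ha)
  · rintro ⟨⟨h1, h2⟩, ⟨h3, h4⟩⟩
    refine ⟨fun w hw => lr_ext (h1 w hw) (h3 w hw), fun a ha => lr_ext ?_ ?_⟩
    · exact (lft_vecMul (Y.A a) (Z.A a) _).trans (h2 a ha)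
    · exact (rgt_vecMul (Y.A a) (Z.A a) _).trans (h4 a ha)

/-- The pairing is constant along the interval. -/
lemma pair_const {m : ℕ} {ε : Fin m → Bool} {X : Rep m ε} {i j : Fin (m + 1)}
    {x f : ∀ w, Fin (X.d w) → ℂ} (hx : IsX X i j x) (hf : IsF X i j f) :
    ∀ n : ℕ, ∀ w : Fin (m + 1), w.val = i.val + n → w ≤ j → f w ⬝ᵥ x w = f i ⬝ᵥ x i := by
  intro n
  induction n with
  | zero => intro w hw _; obtain rfl : w = i := Fin.ext (by simpa using hw); rfl
  | succ n ih =>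
    intro w hw hj
    have hwm := w.2
    obtain ⟨a, ha⟩ : ∃ a : Fin m, a.val = i.val + n := ⟨⟨i.val + n, by omega⟩, rfl⟩
    have hw' : w = a.succ := Fin.ext (by simp; omega)
    have hj' : w.val ≤ j.val := hj
    rw [← ih a.castSucc (by simpa using ha) (by rw [Fin.le_def]; simp; omega)]
    subst hw'
    have key : (i ≤ src ε a ∧ src ε a ≤ j) → (i ≤ tgt ε a ∧ tgt ε a ≤ j) →
        f (tgt ε a) ⬝ᵥ x (tgt ε a) = f (src ε a) ⬝ᵥ x (src ε a) := by
      intro h1 h2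
      rw [← hx.arr a h1, Matrix.dotProduct_mulVec, hf.arr a h2]
    have m1 : i ≤ a.castSucc ∧ a.castSucc ≤ j := by
      simp only [Fin.le_def, Fin.val_succ, Fin.val_castSucc] at *; omega
    have m2 : i ≤ a.succ ∧ a.succ ≤ j := by
      simp only [Fin.le_def, Fin.val_succ, Fin.val_castSucc] at *; omega
    rcases src_tgt ε a with ⟨h1, h2⟩ | ⟨h1, h2⟩
    · rw [h1, h2] at key
      exact key m1 m2
    · rw [h1, h2] at key
      exact (key m2 m1).symm

lemma int_apply {m : ℕ} (ε : Fin m → Bool) (k l : Fin (m + 1)) (a : Fin m)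
    (b : Fin ((interval ε k l).d (tgt ε a))) (c : Fin ((interval ε k l).d (src ε a))) :
    (interval ε k l).A a b c = 1 := rfl

lemma sub_dim {m : ℕ} (ε : Fin m → Bool) (k l w : Fin (m + 1)) :
    Subsingleton (Fin ((interval ε k l).d w)) := by
  unfold interval
  dsimp only
  split_ifs <;> infer_instance

lemma dim_pos {m : ℕ} (ε : Fin m → Bool) {k l w : Fin (m + 1)} (h : k ≤ w ∧ w ≤ l) :
    Nonempty (Fin ((interval ε k l).d w)) := by
  unfold interval
  dsimp only
  rw [if_pos h]; infer_instance

lemma dim_empty {m : ℕ} (ε : Fin m → Bool) {k l w : Fin (m + 1)} (h : ¬ (k ≤ w ∧ w ≤ l)) :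
    IsEmpty (Fin ((interval ε k l).d w)) := by
  unfold interval
  dsimp only
  rw [if_neg h]; infer_instance

lemma int_mulVec {m : ℕ} {ε : Fin m → Bool} {k l : Fin (m + 1)} {a : Fin m}
    (h2 : k ≤ tgt ε a ∧ tgt ε a ≤ l)
    {y : Fin ((interval ε k l).d (src ε a)) → ℂ} (h : (interval ε k l).A a *ᵥ y = 0) : y = 0 := by
  obtain ⟨r⟩ := dim_pos ε h2
  have := sub_dim ε k l (src ε a)
  funext s
  have h3 := congrFun h r
  simp only [mulVec, dotProduct, int_apply, one_mul, Pi.zero_apply] at h3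
  rw [Fintype.sum_subsingleton _ s] at h3
  exact h3

lemma int_vecMul {m : ℕ} {ε : Fin m → Bool} {k l : Fin (m + 1)} {a : Fin m}
    (h2 : k ≤ src ε a ∧ src ε a ≤ l)
    {y : Fin ((interval ε k l).d (tgt ε a)) → ℂ} (h : y ᵥ* (interval ε k l).A a = 0) : y = 0 := by
  obtain ⟨r⟩ := dim_pos ε h2
  have := sub_dim ε k l (tgt ε a)
  funext s
  have h3 := congrFun h r
  simp only [vecMul, dotProduct, int_apply, mul_one, Pi.zero_apply] at h3
  rw [Fintype.sum_subsingleton _ s] at h3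
  exact h3

lemma pair_zero {m : ℕ} {ε : Fin m → Bool} {i j k l : Fin (m + 1)} (hij : i ≤ j)
    (hne : (k, l) ≠ (i, j))
    {x f : ∀ w, Fin ((interval ε k l).d w) → ℂ} (hx : IsX (interval ε k l) i j x)
    (hf : IsF (interval ε k l) i j f) : f i ⬝ᵥ x i = 0 := by
  by_contra h0
  have hc : ∀ w, i ≤ w ∧ w ≤ j → f w ⬝ᵥ x w ≠ 0 := by
    intro w hw
    rw [pair_const hx hf (w.val - i.val) w (by have : i.val ≤ w.val := hw.1; omega) hw.2]
    exact h0
  have hxn : ∀ w, i ≤ w ∧ w ≤ j → x w ≠ 0 := fun w hw h => hc w hw (by rw [h]; simp)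
  have hfn : ∀ w, i ≤ w ∧ w ≤ j → f w ≠ 0 := fun w hw h => hc w hw (by rw [h]; simp)
  have hsub : ∀ w, i ≤ w ∧ w ≤ j → k ≤ w ∧ w ≤ l := by
    intro w hw
    by_contra h
    have := dim_empty ε h
    exact hxn w hw (Subsingleton.elim _ _)
  -- any arrow with both ends in K and one end in I has both ends in I
  have key1 : ∀ a, (k ≤ tgt ε a ∧ tgt ε a ≤ l) → (i ≤ src ε a ∧ src ε a ≤ j) →
      (i ≤ tgt ε a ∧ tgt ε a ≤ j) := by
    intro a h1 h2
    by_contra h3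
    have := hx.arr a h2
    rw [hx.out _ h3] at this
    exact hxn _ h2 (int_mulVec h1 this)
  have key2 : ∀ a, (k ≤ src ε a ∧ src ε a ≤ l) → (i ≤ tgt ε a ∧ tgt ε a ≤ j) →
      (i ≤ src ε a ∧ src ε a ≤ j) := by
    intro a h1 h2
    by_contra h3
    have := hf.arr a h2
    rw [hf.out _ h3] at this
    exact hfn _ h2 (int_vecMul h1 this)
  have hi := hsub i ⟨le_rfl, hij⟩
  have hj := hsub j ⟨hij, le_rfl⟩
  have keyl : ∀ a : Fin m, (k ≤ a.castSucc ∧ a.castSucc ≤ l) → (i ≤ a.succ ∧ a.succ ≤ j) →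
      (i ≤ a.castSucc ∧ a.castSucc ≤ j) := by
    intro a
    rcases src_tgt ε a with ⟨h1, h2⟩ | ⟨h1, h2⟩
    · have := key2 a; rwa [h1, h2] at this
    · have := key1 a; rwa [h1, h2] at this
  have keyr : ∀ a : Fin m, (k ≤ a.succ ∧ a.succ ≤ l) → (i ≤ a.castSucc ∧ a.castSucc ≤ j) →
      (i ≤ a.succ ∧ a.succ ≤ j) := by
    intro a
    rcases src_tgt ε a with ⟨h1, h2⟩ | ⟨h1, h2⟩
    · have := key1 a; rwa [h1, h2] at this
    · have := key2 a; rwa [h1, h2] at this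
  have him := i.2
  have hlm := l.2
  simp only [Fin.le_def, Fin.val_succ, Fin.val_castSucc] at *
  apply hne
  have e1 : k = i := by
    by_contra hki
    have hki' : k.val ≠ i.val := fun h => hki (Fin.ext h)
    have := keyl ⟨i.val - 1, by omega⟩
    simp only at this
    omega
  have e2 : l = j := by
    by_contra hki
    have hki' : l.val ≠ j.val := fun h => hki (Fin.ext h)
    have := keyr ⟨j.val, by omega⟩
    simp only at this
    omega
  rw [e1, e2]

lemma rank_add_le' {n : ℕ} (A B : Matrix (Fin n) (Fin n) ℂ) : (A + B).rank ≤ A.rank + B.rank := by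
  have h : LinearMap.range (A + B).mulVecLin ≤
      LinearMap.range A.mulVecLin ⊔ LinearMap.range B.mulVecLin := by
    rintro _ ⟨y, rfl⟩
    rw [Matrix.mulVecLin_add, LinearMap.add_apply]
    exact Submodule.add_mem_sup ⟨y, rfl⟩ ⟨y, rfl⟩
  exact (Submodule.finrank_mono h).trans (Submodule.finrank_add_le_finrank_add_finrank _ _)

lemma gram_upper {m : ℕ} {ε : Fin m → Bool} {i j : Fin (m + 1)} (hij : i ≤ j) (n : ℕ)
    (L : List (Fin (m + 1) × Fin (m + 1))) :
    ∀ (x f : Fin n → ∀ w, Fin ((dsumList (L.map fun p => interval ε p.1 p.2)).d w) → ℂ),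
    (∀ a, IsX _ i j (x a)) → (∀ a, IsF _ i j (f a)) →
    (Matrix.of fun a b => f a i ⬝ᵥ x b i).rank ≤ L.count (i, j) := by
  induction L with
  | nil =>
    intro x f _ _
    have : (Matrix.of fun a b => f a i ⬝ᵥ x b i) = (0 : Matrix (Fin n) (Fin n) ℂ) := by
      ext a b
      have : IsEmpty (Fin ((dsumList (([] : List (Fin (m + 1) × Fin (m + 1))).map
        fun p => interval ε p.1 p.2)).d i)) := inferInstanceAs (IsEmpty (Fin 0))
      simp [dotProduct]
    rw [this]; simp
  | cons p L ih =>
    intro x f hx hf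
    have hx' : ∀ a, IsX (interval ε p.1 p.2) i j (fun w => lft (x a w)) ∧
      IsX (dsumList (L.map fun p => interval ε p.1 p.2)) i j (fun w => rgt (x a w)) :=
      fun a => isX_dsum.1 (hx a)
    have hf' : ∀ a, IsF (interval ε p.1 p.2) i j (fun w => lft (f a w)) ∧
      IsF (dsumList (L.map fun p => interval ε p.1 p.2)) i j (fun w => rgt (f a w)) :=
      fun a => isF_dsum.1 (hf a)
    have hsum : (Matrix.of fun a b => f a i ⬝ᵥ x b i : Matrix (Fin n) (Fin n) ℂ) =
        (Matrix.of fun a b => (lft (f a i) : Fin ((interval ε p.1 p.2).d i) → ℂ) ⬝ᵥ lft (x b i)) +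
        (Matrix.of fun a b => (rgt (f a i) : Fin ((dsumList (L.map fun p => interval ε p.1 p.2)).d i) → ℂ) ⬝ᵥ rgt (x b i)) := by
      ext a b
      exact dot_lr _ _
    rw [hsum]
    refine (rank_add_le' _ _).trans ?_
    rw [List.count_cons]
    have hih := ih (fun a w => rgt (x a w)) (fun a w => rgt (f a w))
      (fun a => (hx' a).2) (fun a => (hf' a).2)
    refine (add_le_add_right hih _).trans ?_
    rw [add_comm]
    refine Nat.add_le_add_left ?_ _
    by_cases hp : p = (i, j)
    · subst hp
      simp only [beq_self_eq_true, if_true]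
      obtain ⟨r⟩ := dim_pos ε (k := i) (l := j) (w := i) ⟨le_rfl, hij⟩
      have := sub_dim ε i j i
      have e : (Matrix.of fun a b => (lft (f a i) : Fin ((interval ε i j).d i) → ℂ) ⬝ᵥ lft (x b i)
          : Matrix (Fin n) (Fin n) ℂ)
          = Matrix.vecMulVec (fun a => (lft (f a i) : Fin ((interval ε i j).d i) → ℂ) r)
            (fun b => (lft (x b i) : Fin ((interval ε i j).d i) → ℂ) r) := by
        ext a b
        simp only [Matrix.of_apply, Matrix.vecMulVec_apply, dotProduct]
        exact Fintype.sum_subsingleton _ r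
      rw [e]
      exact Matrix.rank_vecMulVec_le _ _
    · have e : (Matrix.of fun a b => (lft (f a i) : Fin ((interval ε p.1 p.2).d i) → ℂ) ⬝ᵥ lft (x b i)
          : Matrix (Fin n) (Fin n) ℂ) = 0 := by
        ext a b
        exact pair_zero hij hp (hx' b).1 (hf' a).1
      rw [e]; simp

lemma isX_zero {m : ℕ} {ε : Fin m → Bool} (X : Rep m ε) (i j : Fin (m + 1)) :
    IsX X i j (fun _ => 0) := ⟨fun _ _ => rfl, fun _ _ => by simp⟩

lemma isF_zero {m : ℕ} {ε : Fin m → Bool} (X : Rep m ε) (i j : Fin (m + 1)) :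
    IsF X i j (fun _ => 0) := ⟨fun _ _ => rfl, fun _ _ => by simp⟩

lemma isX_one {m : ℕ} {ε : Fin m → Bool} (i j : Fin (m + 1)) :
    IsX (interval ε i j) i j (fun _ _ => 1) := by
  constructor
  · intro w hw
    have := dim_empty ε hw
    exact Subsingleton.elim _ _
  · intro a ha
    obtain ⟨r⟩ := dim_pos ε ha
    have := sub_dim ε i j (src ε a)
    funext s
    simp only [mulVec, dotProduct, int_apply, one_mul]
    rw [Fintype.sum_subsingleton _ r]

lemma isF_one {m : ℕ} {ε : Fin m → Bool} (i j : Fin (m + 1)) :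
    IsF (interval ε i j) i j (fun _ _ => 1) := by
  constructor
  · intro w hw
    have := dim_empty ε hw
    exact Subsingleton.elim _ _
  · intro a ha
    obtain ⟨r⟩ := dim_pos ε ha
    have := sub_dim ε i j (tgt ε a)
    funext s
    simp only [vecMul, dotProduct, int_apply, one_mul]
    rw [Fintype.sum_subsingleton _ r]

/-- Vector on a direct sum from its two components. -/
def glue {a b : ℕ} (y : Fin a → ℂ) (z : Fin b → ℂ) : Fin (a + b) → ℂ := Fin.append y z

@[simp] lemma lft_glue {a b : ℕ} (y : Fin a → ℂ) (z : Fin b → ℂ) : lft (glue y z) = y := by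
  funext k; simp [lft, glue]
@[simp] lemma rgt_glue {a b : ℕ} (y : Fin a → ℂ) (z : Fin b → ℂ) : rgt (glue y z) = z := by
  funext k; simp [rgt, glue]

lemma isX_glue {m : ℕ} {ε : Fin m → Bool} {Y Z : Rep m ε} {i j : Fin (m + 1)}
    {y : ∀ w, Fin (Y.d w) → ℂ} {z : ∀ w, Fin (Z.d w) → ℂ} (hy : IsX Y i j y) (hz : IsX Z i j z) :
    IsX (dsum Y Z) i j (fun w => glue (y w) (z w)) := by
  rw [isX_dsum]; simpa using ⟨hy, hz⟩

lemma isF_glue {m : ℕ} {ε : Fin m → Bool} {Y Z : Rep m ε} {i j : Fin (m + 1)}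
    {y : ∀ w, Fin (Y.d w) → ℂ} {z : ∀ w, Fin (Z.d w) → ℂ} (hy : IsF Y i j y) (hz : IsF Z i j z) :
    IsF (dsum Y Z) i j (fun w => glue (y w) (z w)) := by
  rw [isF_dsum]; simpa using ⟨hy, hz⟩

lemma dot_glue {a b : ℕ} (y y' : Fin a → ℂ) (z z' : Fin b → ℂ) :
    glue y z ⬝ᵥ glue y' z' = y ⬝ᵥ y' + z ⬝ᵥ z' := by
  rw [dot_lr]; simp

/-- Existence of `n` morphisms from and to the interval with identity Gram matrix. -/
def HasGram {m : ℕ} {ε : Fin m → Bool} (X : Rep m ε) (i j : Fin (m + 1)) (n : ℕ) : Prop :=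
  ∃ (x f : Fin n → ∀ w, Fin (X.d w) → ℂ), (∀ a, IsX X i j (x a)) ∧ (∀ a, IsF X i j (f a)) ∧
    ∀ a b, f a i ⬝ᵥ x b i = if a = b then 1 else 0

lemma hasGram_dsum {m : ℕ} {ε : Fin m → Bool} {Y Z : Rep m ε} {i j : Fin (m + 1)} {n : ℕ}
    (h : HasGram Z i j n) : HasGram (dsum Y Z) i j n := by
  obtain ⟨x, f, hx, hf, h⟩ := h
  refine ⟨fun a w => glue (0 : Fin (Y.d w) → ℂ) (x a w),
    fun a w => glue (0 : Fin (Y.d w) → ℂ) (f a w), ?_, ?_, ?_⟩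
  · intro a
    exact isX_glue (isX_zero _ i j) (hx a)
  · intro a
    exact isF_glue (isF_zero _ i j) (hf a)
  · intro a b
    refine (dot_glue _ _ _ _).trans ?_
    rw [h, zero_dotProduct, zero_add]

lemma hasGram_dsum_succ {m : ℕ} {ε : Fin m → Bool} {Z : Rep m ε} {i j : Fin (m + 1)} {n : ℕ}
    (hij : i ≤ j) (h : HasGram Z i j n) : HasGram (dsum (interval ε i j) Z) i j (n + 1) := by
  obtain ⟨x, f, hx, hf, h⟩ := h
  let u : ∀ w, Fin ((dsum (interval ε i j) Z).d w) → ℂ :=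
    fun w => glue (fun _ => (1 : ℂ) : Fin ((interval ε i j).d w) → ℂ) (0 : Fin (Z.d w) → ℂ)
  let x' : Fin n → ∀ w, Fin ((dsum (interval ε i j) Z).d w) → ℂ :=
    fun a w => glue (0 : Fin ((interval ε i j).d w) → ℂ) (x a w)
  let f' : Fin n → ∀ w, Fin ((dsum (interval ε i j) Z).d w) → ℂ :=
    fun a w => glue (0 : Fin ((interval ε i j).d w) → ℂ) (f a w)
  have huu : u i ⬝ᵥ u i = 1 := by
    refine (dot_glue _ _ _ _).trans ?_
    obtain ⟨r⟩ := dim_pos ε (k := i) (l := j) (w := i) ⟨le_rfl, hij⟩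
    have := sub_dim ε i j i
    rw [zero_dotProduct, add_zero, dotProduct, Fintype.sum_subsingleton _ r, one_mul]
  have hux : ∀ b, u i ⬝ᵥ x' b i = 0 := fun b => by
    refine (dot_glue _ _ _ _).trans ?_
    rw [zero_dotProduct, dotProduct_zero, add_zero]
  have hfu : ∀ b, f' b i ⬝ᵥ u i = 0 := fun b => by
    refine (dot_glue _ _ _ _).trans ?_
    rw [zero_dotProduct, dotProduct_zero, add_zero]
  have hfx : ∀ a b, f' a i ⬝ᵥ x' b i = if a = b then 1 else 0 := fun a b => by
    refine (dot_glue _ _ _ _).trans ?_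
    rw [h, zero_dotProduct, zero_add]
  have hu1 : IsX _ i j u := isX_glue (isX_one i j) (isX_zero _ i j)
  have hu2 : IsF _ i j u := isF_glue (isF_one i j) (isF_zero _ i j)
  have hx' : ∀ a, IsX _ i j (x' a) := fun a => isX_glue (isX_zero _ i j) (hx a)
  have hf' : ∀ a, IsF _ i j (f' a) := fun a => isF_glue (isF_zero _ i j) (hf a)
  clear_value u x' f'
  refine ⟨fun a => Fin.cases u x' a, fun a => Fin.cases u f' a, ?_, ?_, ?_⟩
  · intro a
    refine Fin.cases ?_ (fun a => ?_) a
    · exact hu1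
    · exact hx' a
  · intro a
    refine Fin.cases ?_ (fun a => ?_) a
    · exact hu2
    · exact hf' a
  · intro a b
    refine Fin.cases ?_ (fun a => ?_) a <;> refine Fin.cases ?_ (fun b => ?_) b
    · simpa using huu
    · rw [if_neg (Fin.succ_ne_zero b).symm]
      exact hux b
    · rw [if_neg (Fin.succ_ne_zero a)]
      exact hfu a
    · simpa using hfx a b

lemma gram_lower {m : ℕ} {ε : Fin m → Bool} {i j : Fin (m + 1)} (hij : i ≤ j)
    (L : List (Fin (m + 1) × Fin (m + 1))) :
    HasGram (dsumList (L.map fun p => interval ε p.1 p.2)) i j (L.count (i, j)) := by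
  induction L with
  | nil =>
    exact ⟨fun a => a.elim0, fun a => a.elim0, fun a => a.elim0, fun a => a.elim0,
      fun a => a.elim0⟩
  | cons p L ih =>
    by_cases hp : p = (i, j)
    · subst hp
      rw [List.count_cons_self]
      exact hasGram_dsum_succ hij ih
    · rw [List.count_cons_of_ne hp]
      exact hasGram_dsum ih

lemma count_le {m : ℕ} {ε : Fin m → Bool} {i j : Fin (m + 1)} (hij : i ≤ j)
    (L L' : List (Fin (m + 1) × Fin (m + 1)))
    (h : Iso (dsumList (L.map fun p => interval ε p.1 p.2))
      (dsumList (L'.map fun p => interval ε p.1 p.2))) : L.count (i, j) ≤ L'.count (i, j) := by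
  obtain ⟨S, T, h1, h2, h3⟩ := h
  obtain ⟨x, f, hx, hf, hg⟩ := gram_lower (ε := ε) hij L
  have := gram_upper (ε := ε) hij _ L' (fun a w => S w *ᵥ x a w) (fun a w => f a w ᵥ* T w)
    (fun a => transport_X h2 h3 (hx a)) (fun a => transport_F h2 h3 (hf a))
  have e : (Matrix.of fun a b => (f a i ᵥ* T i) ⬝ᵥ (S i *ᵥ x b i)) =
      (1 : Matrix (Fin (L.count (i, j))) (Fin (L.count (i, j))) ℂ) := by
    ext a b
    rw [Matrix.of_apply, Matrix.dotProduct_mulVec, Matrix.vecMul_vecMul, h2, Matrix.vecMul_one, hg,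
      Matrix.one_apply]
  rw [e, Matrix.rank_one, Fintype.card_fin] at this
  exact this

lemma uniq {m : ℕ} {ε : Fin m → Bool} 
    (L L' : List (Fin (m + 1) × Fin (m + 1))) (hL : ∀ p ∈ L, p.1 ≤ p.2) (hL' : ∀ p ∈ L', p.1 ≤ p.2)
    (h : Iso (dsumList (L.map fun p => interval ε p.1 p.2))
      (dsumList (L'.map fun p => interval ε p.1 p.2))) :
    (L : Multiset (Fin (m + 1) × Fin (m + 1))) = (L' : Multiset (Fin (m + 1) × Fin (m + 1))) := by
  rw [Multiset.coe_eq_coe, List.perm_iff_count]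
  rintro ⟨i, j⟩
  by_cases hij : i ≤ j
  · exact le_antisymm (count_le hij _ _ h) (count_le hij _ _ (iso_refl_symm h))
  · rw [List.count_eq_zero_of_not_mem (fun hm => hij (hL _ hm)),
      List.count_eq_zero_of_not_mem (fun hm => hij (hL' _ hm))]

/-- Gluing an isomorphism onto a direct sum. -/
lemma iso_dsum {m : ℕ} {ε : Fin m → Bool} {X Y Z : Rep m ε}
    (p : ∀ v, Matrix (Fin (Y.d v)) (Fin (X.d v)) ℂ)
    (P : ∀ v, Matrix (Fin (Z.d v)) (Fin (X.d v)) ℂ)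
    (q : ∀ v, Matrix (Fin (X.d v)) (Fin (Y.d v)) ℂ)
    (Q : ∀ v, Matrix (Fin (X.d v)) (Fin (Z.d v)) ℂ)
    (h1 : ∀ v, p v * q v = 1) (h2 : ∀ v, p v * Q v = 0) (h3 : ∀ v, P v * q v = 0)
    (h4 : ∀ v, P v * Q v = 1) (h5 : ∀ v, q v * p v + Q v * P v = 1)
    (h6 : ∀ a, p (tgt ε a) * X.A a = Y.A a * p (src ε a))
    (h7 : ∀ a, P (tgt ε a) * X.A a = Z.A a * P (src ε a)) : Iso X (dsum Y Z) := by
  refine ⟨fun v => (Matrix.fromRows (p v) (P v)).submatrix finSumFinEquiv.symm id,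
    fun v => (Matrix.fromCols (q v) (Q v)).submatrix id finSumFinEquiv.symm, ?_, ?_, ?_⟩
  · intro v
    have : (Matrix.fromRows (p v) (P v)).submatrix finSumFinEquiv.symm id *
        (Matrix.fromCols (q v) (Q v)).submatrix id finSumFinEquiv.symm =
        (Matrix.fromRows (p v) (P v) * Matrix.fromCols (q v) (Q v)).submatrix
          finSumFinEquiv.symm finSumFinEquiv.symm := by
      rw [Matrix.submatrix_mul _ _ _ _ _ Function.bijective_id]
    refine this.trans ?_
    rw [Matrix.fromRows_mul_fromCols, h1, h2, h3, h4, Matrix.fromBlocks_one,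
      Matrix.submatrix_one_equiv]
    rfl
  · intro v
    have : (Matrix.fromCols (q v) (Q v)).submatrix id finSumFinEquiv.symm *
        (Matrix.fromRows (p v) (P v)).submatrix finSumFinEquiv.symm id =
        (Matrix.fromCols (q v) (Q v) * Matrix.fromRows (p v) (P v)).submatrix id id := by
      exact Matrix.submatrix_mul_equiv _ _ _ finSumFinEquiv.symm _
    refine this.trans ?_
    rw [Matrix.fromCols_mul_fromRows, h5, Matrix.submatrix_id_id]
  · intro a
    have : (Matrix.fromRows (p (tgt ε a)) (P (tgt ε a))).submatrix finSumFinEquiv.symm id * X.A a *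
        (Matrix.fromCols (q (src ε a)) (Q (src ε a))).submatrix id finSumFinEquiv.symm =
        (Matrix.fromRows (p (tgt ε a)) (P (tgt ε a)) * X.A a *
          Matrix.fromCols (q (src ε a)) (Q (src ε a))).submatrix
          finSumFinEquiv.symm finSumFinEquiv.symm := by
      rw [Matrix.submatrix_mul _ _ _ id _ Function.bijective_id,
        Matrix.submatrix_mul _ _ _ id _ Function.bijective_id, Matrix.submatrix_id_id]
    refine Eq.trans ?_ this.symm
    rw [Matrix.fromRows_mul, Matrix.fromRows_mul_fromCols, h6, h7]
    simp only [Matrix.mul_assoc, h1, h2, h3, h4]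
    simp [dsum]

lemma idem_factor {n : ℕ} (E : Matrix (Fin n) (Fin n) ℂ) (hE : E * E = E) :
    ∃ (r : ℕ) (P : Matrix (Fin r) (Fin n) ℂ) (Q : Matrix (Fin n) (Fin r) ℂ),
      P * Q = 1 ∧ Q * P = E := by
  let e := Matrix.toLin' E
  let b := Module.finBasis ℂ (LinearMap.range e)
  let s := Pi.basisFun ℂ (Fin n)
  have he : ∀ y, e (e y) = e y := by
    intro y
    simp only [e, Matrix.toLin'_apply, Matrix.mulVec_mulVec, hE]
  refine ⟨_, LinearMap.toMatrix s b e.rangeRestrict,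
    LinearMap.toMatrix b s (LinearMap.range e).subtype, ?_, ?_⟩
  · rw [← LinearMap.toMatrix_comp, ← LinearMap.toMatrix_id b]
    congr 1
    ext ⟨_, y, rfl⟩ : 2
    simp [he]
  · rw [← LinearMap.toMatrix_comp]
    have : (LinearMap.range e).subtype ∘ₗ e.rangeRestrict = e := by
      ext; simp
    rw [this]
    simp only [s, e, LinearMap.toMatrix_eq_toMatrix', LinearMap.toMatrix'_toLin']

lemma split_off {m : ℕ} {ε : Fin m → Bool} {X : Rep m ε} {i j : Fin (m + 1)}
    {x f : ∀ w, Fin (X.d w) → ℂ} (hij : i ≤ j) (hx : IsX X i j x) (hf : IsF X i j f)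
    (h1 : ∀ w, i ≤ w ∧ w ≤ j → f w ⬝ᵥ x w = 1) :
    ∃ Z : Rep m ε, (∀ w, Z.d w ≤ X.d w) ∧ Z.d i < X.d i ∧
      ∀ Z', Iso Z Z' → Iso X (dsum (interval ε i j) Z') := by
  have hfx : ∀ w, (f w ⬝ᵥ x w) • f w = f w := by
    intro w
    by_cases hw : i ≤ w ∧ w ≤ j
    · rw [h1 w hw, one_smul]
    · rw [hf.out w hw, smul_zero]
  have hxx : ∀ w, (f w ⬝ᵥ x w) • x w = x w := by
    intro w
    by_cases hw : i ≤ w ∧ w ≤ j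
    · rw [h1 w hw, one_smul]
    · rw [hx.out w hw, smul_zero]
  have hE : ∀ w, (1 - Matrix.vecMulVec (x w) (f w)) * (1 - Matrix.vecMulVec (x w) (f w)) =
      1 - Matrix.vecMulVec (x w) (f w) := by
    intro w
    have : Matrix.vecMulVec (x w) (f w) * Matrix.vecMulVec (x w) (f w) =
        Matrix.vecMulVec (x w) (f w) := by
      rw [Matrix.vecMulVec_mul_vecMulVec, hfx]
    rw [mul_sub, sub_mul, sub_mul, this]; simp
  choose r P Q hPQ hQP using fun w => idem_factor _ (hE w)
  have hPx : ∀ w, P w *ᵥ x w = 0 := by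
    intro w
    have : (P w * Q w * P w) *ᵥ x w = 0 := by
      rw [Matrix.mul_assoc, hQP, ← Matrix.mulVec_mulVec, Matrix.sub_mulVec, Matrix.one_mulVec,
        Matrix.vecMulVec_mulVec]
      have := hxx w
      simp [this]
    rwa [hPQ, Matrix.one_mul] at this
  have hfQ : ∀ w, f w ᵥ* Q w = 0 := by
    intro w
    have : f w ᵥ* (Q w * P w * Q w) = 0 := by
      rw [hQP, ← Matrix.vecMul_vecMul, Matrix.vecMul_sub, Matrix.vecMul_one,
        Matrix.vecMul_vecMulVec, hfx]
      simp
    rwa [Matrix.mul_assoc, hPQ, Matrix.mul_one] at this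
  let Z : Rep m ε := ⟨r, fun a => P (tgt ε a) * X.A a * Q (src ε a)⟩
  let p : ∀ v, Matrix (Fin ((interval ε i j).d v)) (Fin (X.d v)) ℂ :=
    fun v => Matrix.of fun _ => f v
  let q : ∀ v, Matrix (Fin (X.d v)) (Fin ((interval ε i j).d v)) ℂ :=
    fun v => Matrix.of fun b _ => x v b
  have hqp : ∀ v, q v * p v = Matrix.vecMulVec (x v) (f v) := by
    intro v
    ext b c
    by_cases hv : i ≤ v ∧ v ≤ j
    · obtain ⟨s⟩ := dim_pos ε hv
      have := sub_dim ε i j v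
      simp only [Matrix.mul_apply, q, p, Matrix.of_apply, Matrix.vecMulVec_apply]
      exact Fintype.sum_subsingleton _ s
    · have := dim_empty ε hv
      simp [Matrix.mul_apply, Matrix.vecMulVec_apply, hf.out v hv]
  have hpq : ∀ v, p v * q v = 1 := by
    intro v
    ext b c
    by_cases hv : i ≤ v ∧ v ≤ j
    · have := sub_dim ε i j v
      obtain rfl : b = c := Subsingleton.elim _ _
      rw [Matrix.one_apply_eq, ← h1 v hv]
      rfl
    · have := dim_empty ε hv
      exact isEmptyElim b
  have hpQ : ∀ v, p v * Q v = 0 := by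
    intro v; ext b c
    exact congrFun (hfQ v) c
  have hPq : ∀ v, P v * q v = 0 := by
    intro v; ext b c
    exact congrFun (hPx v) b
  have hpA : ∀ a, p (tgt ε a) * X.A a = (interval ε i j).A a * p (src ε a) := by
    intro a
    ext b c
    by_cases ht : i ≤ tgt ε a ∧ tgt ε a ≤ j
    · have e1 : (p (tgt ε a) * X.A a) b c = f (src ε a) c := congrFun (hf.arr a ht) c
      rw [e1]
      simp only [Matrix.mul_apply, int_apply, Matrix.of_apply, p, one_mul]
      by_cases hs : i ≤ src ε a ∧ src ε a ≤ j
      · obtain ⟨s⟩ := dim_pos ε hs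
        have := sub_dim ε i j (src ε a)
        exact (Fintype.sum_subsingleton (fun _ => f (src ε a) c) s).symm
      · simp [hf.out _ hs]
    · have := dim_empty ε ht
      exact isEmptyElim b
  have hPA : ∀ a, P (tgt ε a) * X.A a = Z.A a * P (src ε a) := by
    intro a
    change _ = P (tgt ε a) * X.A a * Q (src ε a) * P (src ε a)
    rw [Matrix.mul_assoc _ (Q _), hQP, Matrix.mul_sub, Matrix.mul_one, Matrix.mul_vecMulVec]
    by_cases hs : i ≤ src ε a ∧ src ε a ≤ j
    · rw [← Matrix.mulVec_mulVec, hx.arr a hs, hPx]; simp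
    · rw [hf.out _ hs]; ext; simp [Matrix.vecMulVec_apply]
  have hle : ∀ w, r w + (interval ε i j).d w = X.d w := by
    intro w
    have e1 := congrArg Matrix.trace (hQP w)
    have e2 := congrArg Matrix.trace (hqp w)
    rw [Matrix.trace_mul_comm, hPQ, Matrix.trace_one, Matrix.trace_sub, Matrix.trace_one, ← e2,
      Matrix.trace_mul_comm, hpq, Matrix.trace_one, Fintype.card_fin, Fintype.card_fin,
      Fintype.card_fin, eq_sub_iff_add_eq] at e1
    exact_mod_cast e1
  refine ⟨Z, fun w => ?_, ?_, ?_⟩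
  · have := hle w
    change r w ≤ _
    omega
  · have := hle i
    have h : (interval ε i j).d i = 1 := if_pos ⟨le_rfl, hij⟩
    change r i < _
    omega
  · rintro Z' ⟨S, T, g1, g2, g3⟩
    refine iso_dsum p (fun v => S v * P v) q (fun v => Q v * T v) hpq ?_ ?_ ?_ ?_ hpA ?_
    · intro v; rw [← Matrix.mul_assoc, hpQ, Matrix.zero_mul]
    · intro v; rw [Matrix.mul_assoc, hPq, Matrix.mul_zero]
    · intro v
      rw [Matrix.mul_assoc, ← Matrix.mul_assoc (P v), hPQ, Matrix.one_mul, g1]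
    · intro v
      rw [Matrix.mul_assoc, ← Matrix.mul_assoc (T v)]
      erw [g2]
      rw [Matrix.one_mul, hQP, hqp]
      abel
    · intro a
      rw [Matrix.mul_assoc (S _) (P _), hPA, g3, Matrix.mul_assoc (S _ * Z.A a),
        ← Matrix.mul_assoc (T _), g2, Matrix.one_mul, Matrix.mul_assoc (S _) (Z.A a)]

lemma exists_sep {n : ℕ} (U : Submodule ℂ (Fin n → ℂ)) {x : Fin n → ℂ} (hx : x ∉ U) :
    ∃ f : Fin n → ℂ, (∀ u ∈ U, f ⬝ᵥ u = 0) ∧ f ⬝ᵥ x = 1 := by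
  obtain ⟨g, hg, hU⟩ := Submodule.exists_le_ker_of_notMem hx
  have key : ∀ y, (fun k => (g x)⁻¹ * g (Pi.single k 1)) ⬝ᵥ y = (g x)⁻¹ * g y := by
    intro y
    conv_rhs => rw [LinearMap.pi_apply_eq_sum_univ g y]
    simp only [dotProduct, Finset.mul_sum, smul_eq_mul]
    refine Finset.sum_congr rfl fun k _ => ?_
    have : (fun j => if k = j then (1:ℂ) else 0) = Pi.single k 1 := by
      funext j; simp [Pi.single_apply, eq_comm]
    rw [this]; ring
  refine ⟨fun k => (g x)⁻¹ * g (Pi.single k 1), fun u hu => ?_, ?_⟩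
  · rw [key, show g u = 0 from hU hu, mul_zero]
  · rw [key, inv_mul_cancel₀ hg]

/-- Extension of a functional along a matrix. -/
lemma exists_ext {n k : ℕ} (U : Submodule ℂ (Fin n → ℂ)) (B : Matrix (Fin n) (Fin k) ℂ)
    (g : Fin k → ℂ) (hg : ∀ y, B *ᵥ y ∈ U → g ⬝ᵥ y = 0) :
    ∃ f : Fin n → ℂ, (∀ u ∈ U, f ⬝ᵥ u = 0) ∧ f ᵥ* B = g := by
  -- work in the quotient by `U`
  let φ : (Fin k → ℂ) →ₗ[ℂ] ((Fin n → ℂ) ⧸ U) := U.mkQ ∘ₗ Matrix.toLin' B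
  let γ : (Fin k → ℂ) →ₗ[ℂ] ℂ := 
    { toFun := fun y => g ⬝ᵥ y
      map_add' := fun a b => dotProduct_add _ _ _
      map_smul' := fun a b => by simp }
  have hk : LinearMap.ker φ ≤ LinearMap.ker γ := by
    intro y hy
    apply hg
    simpa [φ] using hy
  obtain ⟨h, hh⟩ : ∃ h : ((Fin n → ℂ) ⧸ U) →ₗ[ℂ] ℂ, h ∘ₗ φ = γ := by
    have := LinearMap.range_dualMap_eq_dualAnnihilator_ker φ
    have hm : γ ∈ (LinearMap.ker φ).dualAnnihilator := by
      rw [Submodule.mem_dualAnnihilator]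
      intro w hw
      exact hk hw
    rw [← this] at hm
    obtain ⟨h, hh⟩ := hm
    exact ⟨h, hh⟩
  have key : ∀ y, (fun k => h (U.mkQ (Pi.single k 1))) ⬝ᵥ y = h (U.mkQ y) := by
    intro y
    have := LinearMap.pi_apply_eq_sum_univ (h ∘ₗ U.mkQ) y
    rw [LinearMap.comp_apply] at this
    rw [this]
    simp only [dotProduct, smul_eq_mul]
    refine Finset.sum_congr rfl fun k _ => ?_
    have : (fun j => if k = j then (1:ℂ) else 0) = Pi.single k 1 := by
      funext j; simp [Pi.single_apply, eq_comm]
    rw [this, mul_comm]; rfl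
  refine ⟨fun k => h (U.mkQ (Pi.single k 1)), fun u hu => ?_, ?_⟩
  · rw [key]
    have : U.mkQ u = 0 := by simpa using hu
    rw [this, map_zero]
  · funext s
    have e := key (B *ᵥ Pi.single s 1)
    rw [Matrix.dotProduct_mulVec] at e
    simp only [dotProduct_single_one] at e
    rw [e]
    have := LinearMap.congr_fun hh (Pi.single s 1)
    simp only [φ, γ, LinearMap.comp_apply, Matrix.toLin'_apply, LinearMap.coe_mk, AddHom.coe_mk,
      dotProduct_single_one] at this
    exact this

/-- The data produced by the inductive construction. -/
structure Good {m : ℕ} {ε : Fin m → Bool} (X : Rep m ε) (v j : Fin (m + 1))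
    (x f : ∀ w, Fin (X.d w) → ℂ) : Prop where
  le : v ≤ j
  one : ∀ w, v ≤ w ∧ w ≤ j → f w ⬝ᵥ x w = 1
  xout : ∀ w, ¬ (v ≤ w ∧ w ≤ j) → x w = 0
  fout : ∀ w, ¬ (v ≤ w ∧ w ≤ j) → f w = 0
  xarr : ∀ a : Fin m, v ≤ a.castSucc → (v ≤ src ε a ∧ src ε a ≤ j) →
    X.A a *ᵥ x (src ε a) = x (tgt ε a)
  farr : ∀ a : Fin m, v ≤ a.castSucc → (v ≤ tgt ε a ∧ tgt ε a ≤ j) →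
    f (tgt ε a) ᵥ* X.A a = f (src ε a)

/-- A one-vertex interval. -/
lemma good_single {m : ℕ} {ε : Fin m → Bool} (X : Rep m ε) (v : Fin (m + 1))
    (x0 f0 : Fin (X.d v) → ℂ) (h : f0 ⬝ᵥ x0 = 1)
    (hx : ∀ a : Fin m, v = a.castSucc → ∀ e : src ε a = v, X.A a *ᵥ (e ▸ x0) = 0)
    (hf : ∀ a : Fin m, v = a.castSucc → ∀ e : tgt ε a = v, (e ▸ f0) ᵥ* X.A a = 0) :
    Good X v v (Function.update (fun _ => 0) v x0) (Function.update (fun _ => 0) v f0) := by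
  have hcs : ∀ a : Fin m, v ≤ a.castSucc → (src ε a = v ∨ tgt ε a = v) → v = a.castSucc := by
    intro a h1 h2
    rw [Fin.le_def] at h1
    apply Fin.ext
    simp only [Fin.val_castSucc] at h1 ⊢
    rcases src_tgt ε a with ⟨h3, h4⟩ | ⟨h3, h4⟩ <;> rw [h3, h4] at h2 <;>
      rcases h2 with h2 | h2 <;> have := congrArg Fin.val h2 <;> simp at this <;> omega
  have hne : ∀ a : Fin m, src ε a ≠ tgt ε a := by
    intro a h2
    rcases src_tgt ε a with ⟨h3, h4⟩ | ⟨h3, h4⟩ <;> rw [h3, h4] at h2 <;>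
      have := congrArg Fin.val h2 <;> simp at this
  refine ⟨le_rfl, ?_, ?_, ?_, ?_, ?_⟩
  · rintro w ⟨h1, h2⟩
    obtain rfl := le_antisymm h1 h2
    simpa using h
  · intro w hw
    exact Function.update_of_ne (fun e => hw (by rw [e]; exact ⟨le_rfl, le_rfl⟩)) _ _
  · intro w hw
    exact Function.update_of_ne (fun e => hw (by rw [e]; exact ⟨le_rfl, le_rfl⟩)) _ _
  · rintro a ha ⟨h1, h2⟩
    have e := le_antisymm h1 h2
    have hv := hcs a ha (Or.inl e.symm)
    subst e
    rw [Function.update_self, Function.update_of_ne (hne a).symm]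
    exact hx a hv rfl
  · rintro a ha ⟨h1, h2⟩
    have e := le_antisymm h1 h2
    have hv := hcs a ha (Or.inr e.symm)
    subst e
    rw [Function.update_self, Function.update_of_ne (hne a)]
    exact hf a hv rfl

/-- Extending an interval by one vertex to the left. -/
lemma good_extend {m : ℕ} {ε : Fin m → Bool} (X : Rep m ε) (a : Fin m) (v v' j : Fin (m + 1))
    (hv : v = a.castSucc) (hv' : v' = a.succ) (x f : ∀ w, Fin (X.d w) → ℂ)
    (hg : Good X v' j x f) (x0 f0 : Fin (X.d v) → ℂ) (h : f0 ⬝ᵥ x0 = 1)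
    (hx1 : ∀ e : src ε a = v, X.A a *ᵥ (e ▸ x0) = x (tgt ε a))
    (hf1 : ∀ e : src ε a = v, f (tgt ε a) ᵥ* X.A a = e ▸ f0)
    (hx2 : ∀ e : tgt ε a = v, X.A a *ᵥ x (src ε a) = e ▸ x0)
    (hf2 : ∀ e : tgt ε a = v, (e ▸ f0) ᵥ* X.A a = f (src ε a)) :
    Good X v j (Function.update x v x0) (Function.update f v f0) := by
  have hvv : v.val + 1 = v'.val := by rw [hv, hv']; simp
  have hle : v'.val ≤ j.val := hg.le
  have hne : src ε a ≠ tgt ε a := by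
    intro h2
    rcases src_tgt ε a with ⟨h3, h4⟩ | ⟨h3, h4⟩ <;> rw [h3, h4] at h2 <;>
      have := congrArg Fin.val h2 <;> simp at this
  have hst : src ε a = v ∨ tgt ε a = v := by
    rcases src_tgt ε a with ⟨h3, h4⟩ | ⟨h3, h4⟩
    · left; rw [h3, hv]
    · right; rw [h4, hv]
  have hmem : ∀ w, w ≠ v → ((v ≤ w ∧ w ≤ j) ↔ (v' ≤ w ∧ w ≤ j)) := by
    intro w hw
    have : w.val ≠ v.val := fun e => hw (Fin.ext e)
    simp only [Fin.le_def]
    omega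
  have hb : ∀ b : Fin m, v ≤ b.castSucc → b ≠ a →
      v' ≤ b.castSucc ∧ src ε b ≠ v ∧ tgt ε b ≠ v := by
    intro b hb hba
    have hba' : b.val ≠ a.val := fun e => hba (Fin.ext e)
    have hav := congrArg Fin.val hv
    rw [Fin.le_def] at hb ⊢
    simp only [Fin.val_castSucc, ne_eq, Fin.ext_iff] at *
    rcases src_tgt ε b with ⟨h3, h4⟩ | ⟨h3, h4⟩ <;> rw [h3, h4] <;>
      simp only [Fin.val_castSucc, Fin.val_succ] <;> omega
  refine ⟨?_, ?_, ?_, ?_, ?_, ?_⟩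
  · rw [Fin.le_def]; omega
  · intro w hw
    by_cases e : w = v
    · subst e; simpa using h
    · rw [Function.update_of_ne e, Function.update_of_ne e]
      exact hg.one w ((hmem w e).1 hw)
  · intro w hw
    have e : w ≠ v := fun e => hw (by rw [e, Fin.le_def, Fin.le_def]; omega)
    rw [Function.update_of_ne e]
    exact hg.xout w (fun h => hw ((hmem w e).2 h))
  · intro w hw
    have e : w ≠ v := fun e => hw (by rw [e, Fin.le_def, Fin.le_def]; omega)
    rw [Function.update_of_ne e]
    exact hg.fout w (fun h => hw ((hmem w e).2 h))
  · intro b hb1 hb2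
    by_cases hba : b = a
    · subst hba
      rcases hst with e | e
      · have e2 : tgt ε b ≠ v := fun h => hne (e.trans h.symm)
        rw [Function.update_of_ne e2, ← hx1 e]
        subst e
        rw [Function.update_self]
      · have e2 : src ε b ≠ v := fun h => hne (h.trans e.symm)
        rw [Function.update_of_ne e2, hx2 e]
        subst e
        rw [Function.update_self]
    · obtain ⟨c1, c2, c3⟩ := hb b hb1 hba
      rw [Function.update_of_ne c2, Function.update_of_ne c3]
      exact hg.xarr b c1 ((hmem _ c2).1 hb2)
  · intro b hb1 hb2
    by_cases hba : b = a
    · subst hba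
      rcases hst with e | e
      · have e2 : tgt ε b ≠ v := fun h => hne (e.trans h.symm)
        rw [Function.update_of_ne e2, hf1 e]
        subst e
        rw [Function.update_self]
      · have e2 : src ε b ≠ v := fun h => hne (h.trans e.symm)
        rw [Function.update_of_ne e2, ← hf2 e]
        subst e
        rw [Function.update_self]
    · obtain ⟨c1, c2, c3⟩ := hb b hb1 hba
      rw [Function.update_of_ne c2, Function.update_of_ne c3]
      exact hg.farr b c1 ((hmem _ c3).1 hb2)

lemma exists_good {m : ℕ} {ε : Fin m → Bool} (X : Rep m ε) :
    ∀ (n : ℕ) (v : Fin (m + 1)), v.val + n = m →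
    ∀ U W : Submodule ℂ (Fin (X.d v) → ℂ), U ≤ W → ¬ W ≤ U →
    ∃ j x f, Good X v j x f ∧ x v ∈ W ∧ ∀ u ∈ U, f v ⬝ᵥ u = 0 := by
  intro n
  induction n with
  | zero =>
    intro v hv U W _ hWU
    obtain ⟨x0, hxW, hxU⟩ := SetLike.not_le_iff_exists.1 hWU
    obtain ⟨f0, hfU, hfx⟩ := exists_sep U hxU
    refine ⟨v, _, _, good_single X v x0 f0 hfx ?_ ?_, ?_, ?_⟩
    · intro a ha
      have := congrArg Fin.val ha
      have := a.2
      simp at *; omega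
    · intro a ha
      have := congrArg Fin.val ha
      have := a.2
      simp at *; omega
    · simpa using hxW
    · simpa using hfU
  | succ n ih =>
    intro v hv U W hUW hWU
    let a : Fin m := ⟨v.val, by omega⟩
    have hva : v = a.castSucc := Fin.ext rfl
    have hone : ∀ b : Fin m, v = b.castSucc → b = a := by
      intro b hb
      apply Fin.ext
      exact (congrArg Fin.val hb).symm
    clear_value a
    have ih' := ih a.succ (by have := congrArg Fin.val hva; simp at *; omega)
    rcases src_tgt ε a with ⟨hs, ht⟩ | ⟨hs, ht⟩
    · have hvs : v = src ε a := hva.trans hs.symm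
      have hnt : tgt ε a ≠ src ε a := by
        intro e; rw [hs, ht] at e; have := congrArg Fin.val e; simp at this
      rw [← ht] at ih'
      subst hvs
      by_cases hk : ∃ x0 ∈ W, X.A a *ᵥ x0 = 0 ∧ x0 ∉ U
      · obtain ⟨x0, hxW, hx0, hxU⟩ := hk
        obtain ⟨f0, hfU, hfx⟩ := exists_sep U hxU
        refine ⟨_, _, _, good_single X _ x0 f0 hfx ?_ ?_, ?_, ?_⟩
        · intro b hb e
          obtain rfl := hone b hb
          exact hx0
        · intro b hb e
          obtain rfl := hone b hb
          exact absurd e hnt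
        · simpa using hxW
        · simpa using hfU
      · push Not at hk
        obtain ⟨j, x, f, hg, hxW, hfU⟩ := ih' (U.map (Matrix.toLin' (X.A a)))
          (W.map (Matrix.toLin' (X.A a))) (Submodule.map_mono hUW) (by
            intro hle
            apply hWU
            intro w hw
            obtain ⟨u, hu, huw⟩ := hle (Submodule.mem_map_of_mem hw)
            have h0 := hk (w - u) (W.sub_mem hw (hUW hu)) (by
              simp only [Matrix.toLin'_apply] at huw
              rw [Matrix.mulVec_sub, huw, sub_self])
            simpa using U.add_mem h0 hu)
        obtain ⟨x0, hx0W, hx0⟩ := hxW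
        rw [Matrix.toLin'_apply] at hx0
        refine ⟨j, _, _, good_extend X a (src ε a) (tgt ε a) j hs ht x f hg x0
          (f (tgt ε a) ᵥ* X.A a) ?_ (fun e => hx0) (fun e => rfl)
          (fun e => absurd e hnt) (fun e => absurd e hnt), ?_, ?_⟩
        · rw [← Matrix.dotProduct_mulVec, hx0]
          exact hg.one _ ⟨le_rfl, hg.le⟩
        · simpa using hx0W
        · intro u hu
          rw [Function.update_self, ← Matrix.dotProduct_mulVec]
          exact hfU _ ⟨u, hu, rfl⟩
    · have hvs : v = tgt ε a := hva.trans ht.symm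
      have hnt : src ε a ≠ tgt ε a := by
        intro e; rw [hs, ht] at e; have := congrArg Fin.val e; simp at this
      rw [← hs] at ih'
      subst hvs
      by_cases hk : W.comap (Matrix.toLin' (X.A a)) ≤ U.comap (Matrix.toLin' (X.A a))
      · obtain ⟨x0, hxW, hxU⟩ := SetLike.not_le_iff_exists.1 hWU
        have hxU' : x0 ∉ U ⊔ LinearMap.range (Matrix.toLin' (X.A a)) := by
          intro hx
          obtain ⟨u, hu, _, ⟨y, rfl⟩, huy⟩ := Submodule.mem_sup.1 hx
          have : y ∈ W.comap (Matrix.toLin' (X.A a)) := by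
            rw [Submodule.mem_comap, eq_sub_of_add_eq' huy]
            exact W.sub_mem hxW (hUW hu)
          apply hxU
          rw [← huy]
          exact U.add_mem hu (hk this)
        obtain ⟨f0, hfU, hfx⟩ := exists_sep _ hxU'
        refine ⟨_, _, _, good_single X _ x0 f0 hfx ?_ ?_, ?_, ?_⟩
        · intro b hb e
          obtain rfl := hone b hb
          exact absurd e hnt
        · intro b hb e
          obtain rfl := hone b hb
          change f0 ᵥ* X.A b = 0
          funext s
          have := hfU (X.A b *ᵥ Pi.single s 1) (Submodule.mem_sup_right ⟨_, Matrix.toLin'_apply _ _⟩)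
          rw [Matrix.dotProduct_mulVec, dotProduct_single_one] at this
          exact this
        · simpa using hxW
        · intro u hu
          rw [Function.update_self]
          exact hfU u (Submodule.mem_sup_left hu)
      · obtain ⟨j, x, f, hg, hxW, hfU⟩ := ih' (U.comap (Matrix.toLin' (X.A a)))
          (W.comap (Matrix.toLin' (X.A a))) (Submodule.comap_mono hUW) hk
        rw [Submodule.mem_comap, Matrix.toLin'_apply] at hxW
        obtain ⟨f0, hf0U, hf0⟩ := exists_ext U (X.A a) (f (src ε a)) (by
          intro y hy
          exact hfU y (by rwa [Submodule.mem_comap, Matrix.toLin'_apply]))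
        refine ⟨j, _, _, good_extend X a (tgt ε a) (src ε a) j ht hs x f hg
          (X.A a *ᵥ x (src ε a)) f0 ?_ (fun e => absurd e hnt) (fun e => absurd e hnt)
          (fun e => rfl) (fun e => hf0), ?_, ?_⟩
        · rw [Matrix.dotProduct_mulVec, hf0]
          exact hg.one _ ⟨le_rfl, hg.le⟩
        · simpa using hxW
        · simpa using hf0U

lemma exists_decomp {m : ℕ} {ε : Fin m → Bool} : ∀ (N : ℕ) (X : Rep m ε), ∑ v, X.d v = N →
    ∃ L : List (Fin (m + 1) × Fin (m + 1)), (∀ p ∈ L, p.1 ≤ p.2) ∧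
      Iso X (dsumList (L.map fun p => interval ε p.1 p.2)) := by
  intro N
  induction N using Nat.strong_induction_on with
  | _ N ih =>
  intro X hN
  by_cases h0 : ∀ v, X.d v = 0
  · refine ⟨[], by simp, ?_⟩
    have he : ∀ v, IsEmpty (Fin (X.d v)) := fun v => by rw [h0 v]; infer_instance
    have he' : ∀ v, IsEmpty (Fin ((zero m ε).d v)) := fun v => inferInstanceAs (IsEmpty (Fin 0))
    refine ⟨fun v => 0, fun v => 0, fun v => ?_, fun v => ?_, fun a => ?_⟩
    · ext b; exact (he' v).elim b
    · ext b; exact (he v).elim b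
    · ext b; exact (he' _).elim b
  · push Not at h0
    -- first nonzero vertex
    obtain ⟨v, hv, hmin⟩ : ∃ v, X.d v ≠ 0 ∧ ∀ w, w < v → X.d w = 0 := by
      have hne : (Finset.univ.filter fun v => X.d v ≠ 0).Nonempty := by
        obtain ⟨v, hv⟩ := h0
        exact ⟨v, by simpa using hv⟩
      refine ⟨Finset.min' _ hne, ?_, ?_⟩
      · have := Finset.min'_mem _ hne
        simpa using this
      · intro w hw
        by_contra h
        exact absurd (Finset.min'_le _ w (by simpa using h)) (not_le.2 hw)
    obtain ⟨j, x, f, hg, -, -⟩ := exists_good X (m - v.val) v (by have := v.2; omega) ⊥ ⊤ bot_le (by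
      intro h
      have h1 : (fun _ => 1 : Fin (X.d v) → ℂ) ∈ (⊥ : Submodule ℂ (Fin (X.d v) → ℂ)) := h trivial
      rw [Submodule.mem_bot] at h1
      have := congrFun h1 ⟨0, Nat.pos_of_ne_zero hv⟩
      simp at this)
    have hsub : ∀ w, w < v → Subsingleton (Fin (X.d w) → ℂ) := by
      intro w hw
      have : IsEmpty (Fin (X.d w)) := by rw [hmin w hw]; infer_instance
      infer_instance
    have hx : IsX X v j x := by
      refine ⟨hg.xout, fun a ha => ?_⟩
      by_cases hc : v ≤ a.castSucc
      · exact hg.xarr a hc ha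
      · have : tgt ε a < v := by
          rcases src_tgt ε a with ⟨h1, h2⟩ | ⟨h1, h2⟩
          · rw [h1] at ha; exact absurd ha.1 hc
          · rw [h2]; exact not_le.1 hc
        exact (hsub _ this).elim _ _
    have hf : IsF X v j f := by
      refine ⟨hg.fout, fun a ha => ?_⟩
      by_cases hc : v ≤ a.castSucc
      · exact hg.farr a hc ha
      · have : src ε a < v := by
          rcases src_tgt ε a with ⟨h1, h2⟩ | ⟨h1, h2⟩
          · rw [h1]; exact not_le.1 hc
          · rw [h2] at ha; exact absurd ha.1 hc
        exact (hsub _ this).elim _ _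
    obtain ⟨Z, hZ1, hZ2, hZ⟩ := split_off hg.le hx hf hg.one
    obtain ⟨L, hL, hLi⟩ := ih (∑ w, Z.d w) (by
      rw [← hN]
      exact Finset.sum_lt_sum (fun w _ => hZ1 w) ⟨v, Finset.mem_univ _, hZ2⟩) Z rfl
    refine ⟨(v, j) :: L, ?_, hZ _ hLi⟩
    intro p hp
    rcases List.mem_cons.1 hp with rfl | hp
    · exact hg.le
    · exact hL p hp

/-- Gabriel's theorem for chains: every matrix representation of the chain quiver
(with `t = m + 1 ≥ 1` vertices and arbitrary orientation `ε`) is isomorphic to a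
direct sum of representations `L_{ij}` with `i ≤ j`, and the multiset of pairs
`(i, j)` occurring is uniquely determined by the representation. -/
theorem chain_canonical_form (m : ℕ) (ε : Fin m → Bool) (X : Rep m ε) :
    ∃ L : List (Fin (m + 1) × Fin (m + 1)),
      (∀ p ∈ L, p.1 ≤ p.2) ∧
      Iso X (dsumList (L.map fun p => interval ε p.1 p.2)) ∧
      ∀ L' : List (Fin (m + 1) × Fin (m + 1)), (∀ p ∈ L', p.1 ≤ p.2) →
        Iso X (dsumList (L'.map fun p => interval ε p.1 p.2)) →
        (L : Multiset (Fin (m + 1) × Fin (m + 1))) =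
          (L' : Multiset (Fin (m + 1) × Fin (m + 1))) := by
  obtain ⟨L, hL, hi⟩ := exists_decomp _ X rfl
  exact ⟨L, hL, hi, fun L' hL' hi' => uniq L L' hL hL' (iso_trans (iso_refl_symm hi) hi')⟩

end ChainQuiver
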